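/- The point p = ((1:1), (1:1), (1:1)) of ℂP¹ × ℂP¹ × ℂP¹ lies in the closure of F, yet the map φ has no limit at p along F: there is no point q ∈ ℂP¹ × ℂP¹ × ℂP¹ such that φ tends to q along the filter of neighborhoods of p within F (nhdsWithin p F). (The homeomorphism f₁₂,₁₃ : F₁₂ → F₁₃ cannot be continuously extended to the point ((1:1),(1:1),(1:1)); this is the reason the universal space of parameters of G_{5,2} is obtained by blowing up this point.) -/

import Mathlib

open scoped LinearAlgebra.Projectivization

/-- The quotient topology on the complex projective line. -/
noncomputable instance : TopologicalSpace (ℙ ℂ (Fin 2 → ℂ)) := instTopologicalSpaceQuotient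

/-- The point of the complex projective line with homogeneous coordinates `(a : b)`. -/
noncomputable def pt (a b : ℂ) (h : a ≠ 0 ∨ b ≠ 0) : ℙ ℂ (Fin 2 → ℂ) :=
  Projectivization.mk ℂ ![a, b] (fun hz => by
    rcases h with h | h
    · exact h (by simpa using congrFun hz 0)
    · exact h (by simpa using congrFun hz 1))

/-- The point `(a : b)` of `ℂP¹` for possibly degenerate data (junk value `(1:0)` if
`a = b = 0`). -/
noncomputable def pt' (a b : ℂ) : ℙ ℂ (Fin 2 → ℂ) :=
  if h : a ≠ 0 ∨ b ≠ 0 then pt a b h else pt 1 0 (Or.inl one_ne_zero)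

/-- The space of parameters `F` of the main stratum of `G_{5,2}`, as a subset of
`ℂP¹ × ℂP¹ × ℂP¹`: triples `((c₁:c₁'), (c₂:c₂'), (c₃:c₃'))` with `c₁c₂'c₃ = c₁'c₂c₃'` and
`cᵢ, cᵢ' ≠ 0`, `cᵢ ≠ cᵢ'`. -/
def Fset : Set (ℙ ℂ (Fin 2 → ℂ) × ℙ ℂ (Fin 2 → ℂ) × ℙ ℂ (Fin 2 → ℂ)) :=
  {p | ∃ (c₁ c₁' c₂ c₂' c₃ c₃' : ℂ) (h₁ : c₁ ≠ 0) (h₂ : c₂ ≠ 0) (h₃ : c₃ ≠ 0),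
    c₁' ≠ 0 ∧ c₂' ≠ 0 ∧ c₃' ≠ 0 ∧ c₁ ≠ c₁' ∧ c₂ ≠ c₂' ∧ c₃ ≠ c₃' ∧
    c₁ * c₂' * c₃ = c₁' * c₂ * c₃' ∧
    p = (pt c₁ c₁' (Or.inl h₁), pt c₂ c₂' (Or.inl h₂), pt c₃ c₃' (Or.inl h₃))}

/-- The transition map `φ = f₁₂,₁₃`,
`((c₁:c₁'), (c₂:c₂'), (c₃:c₃')) ↦ ((c₁ : c₁-c₁'), (c₂ : c₂-c₂'), ((c₁-c₁')c₂'c₃ : c₁'(c₂-c₂')c₃'))`,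
written in terms of chosen homogeneous representatives; its restriction to the space of
parameters `F` (where the formula is independent of the chosen representatives) is the
transition homeomorphism between the charts `M₁₂` and `M₁₃` of `G_{5,2}`. -/
noncomputable def phiFun (p : ℙ ℂ (Fin 2 → ℂ) × ℙ ℂ (Fin 2 → ℂ) × ℙ ℂ (Fin 2 → ℂ)) :
    ℙ ℂ (Fin 2 → ℂ) × ℙ ℂ (Fin 2 → ℂ) × ℙ ℂ (Fin 2 → ℂ) :=
  (pt' (p.1.rep 0) (p.1.rep 0 - p.1.rep 1),
   pt' (p.2.1.rep 0) (p.2.1.rep 0 - p.2.1.rep 1),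
   pt' ((p.1.rep 0 - p.1.rep 1) * p.2.1.rep 1 * p.2.2.rep 0)
       (p.1.rep 1 * (p.2.1.rep 0 - p.2.1.rep 1) * p.2.2.rep 1))

noncomputable def gAux (v : {v : Fin 2 → ℂ // v ≠ 0}) : ℝ :=
  ‖v.1 0‖ ^ 2 / (‖v.1 0‖ ^ 2 + ‖v.1 1‖ ^ 2)

lemma gAux_inv (a b : {v : Fin 2 → ℂ // v ≠ 0}) (t : ℂ) (h : (a : Fin 2 → ℂ) = t • (b : Fin 2 → ℂ)) :
    gAux a = gAux b := by
  have ht : t ≠ 0 := by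
    rintro rfl
    exact a.2 (by simpa using h)
  have ht' : ‖t‖ ^ 2 ≠ 0 := by simpa using ht
  unfold gAux
  rw [h]
  simp only [Pi.smul_apply, smul_eq_mul, norm_mul, mul_pow]
  rw [← mul_add, mul_div_mul_left _ _ ht']

noncomputable def gP : ℙ ℂ (Fin 2 → ℂ) → ℝ := Projectivization.lift gAux gAux_inv

lemma gAux_cont : Continuous gAux := by
  unfold gAux
  have hk : ∀ i : Fin 2, Continuous (fun v : {v : Fin 2 → ℂ // v ≠ 0} => ‖v.1 i‖ ^ 2) :=
    fun i => (((continuous_apply i).comp continuous_subtype_val).norm).pow 2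
  refine Continuous.div (hk 0) ((hk 0).add (hk 1)) ?_
  intro v hv
  apply v.2
  have h0 := sq_nonneg ‖v.1 0‖
  have h1 := sq_nonneg ‖v.1 1‖
  have e0 : ‖v.1 0‖ ^ 2 = 0 := by linarith
  have e1 : ‖v.1 1‖ ^ 2 = 0 := by linarith
  funext i
  fin_cases i
  · simpa using e0
  · simpa using e1

lemma gP_cont : Continuous gP := gAux_cont.quotient_lift _

lemma gP_pt' (m x y : ℂ) (hm : m ≠ 0) (hx : x ≠ 0) :
    gP (pt' (m * x) (m * y)) = ‖x‖ ^ 2 / (‖x‖ ^ 2 + ‖y‖ ^ 2) := by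
  have h : m * x ≠ 0 ∨ m * y ≠ 0 := Or.inl (mul_ne_zero hm hx)
  have ht' : ‖m‖ ^ 2 ≠ 0 := by simpa using hm
  rw [pt', dif_pos h, pt, gP, Projectivization.lift_mk, gAux]
  simp only [Matrix.cons_val_zero, Matrix.cons_val_one, norm_mul, mul_pow]
  rw [← mul_add, mul_div_mul_left _ _ ht']

lemma rep_pt (a b : ℂ) (h : a ≠ 0 ∨ b ≠ 0) :
    ∃ m : ℂ, m ≠ 0 ∧ (pt a b h).rep 0 = m * a ∧ (pt a b h).rep 1 = m * b := by
  obtain ⟨m, hm⟩ := Projectivization.exists_smul_eq_mk_rep ℂ ![a, b] (fun hz => by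
    rcases h with h | h
    · exact h (by simpa using congrFun hz 0)
    · exact h (by simpa using congrFun hz 1))
  refine ⟨m, m.ne_zero, ?_, ?_⟩
  · rw [pt, ← hm]; simp [Units.smul_def]
  · rw [pt, ← hm]; simp [Units.smul_def]

lemma pt_tendsto (u v : ℕ → ℂ) (h : ∀ n, u n ≠ 0 ∨ v n ≠ 0)
    (hu : Filter.Tendsto u Filter.atTop (nhds 1)) (hv : Filter.Tendsto v Filter.atTop (nhds 1)) :
    Filter.Tendsto (fun n => pt (u n) (v n) (h n)) Filter.atTop
      (nhds (pt 1 1 (Or.inl one_ne_zero))) := by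
  have hc : Continuous (fun w : {w : Fin 2 → ℂ // w ≠ 0} => Projectivization.mk ℂ w.1 w.2) :=
    continuous_quotient_mk'
  have hn : ∀ (a b : ℂ), (a ≠ 0 ∨ b ≠ 0) → ![a, b] ≠ 0 := by
    intro a b h hz
    rcases h with h | h
    · exact h (by simpa using congrFun hz 0)
    · exact h (by simpa using congrFun hz 1)
  have key : Filter.Tendsto (fun n => (⟨![u n, v n], hn _ _ (h n)⟩ : {w : Fin 2 → ℂ // w ≠ 0}))
      Filter.atTop (nhds ⟨![1, 1], hn _ _ (Or.inl one_ne_zero)⟩) := by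
    rw [tendsto_subtype_rng, tendsto_pi_nhds]
    intro i
    fin_cases i
    · simpa using hu
    · simpa using hv
  exact (hc.tendsto _).comp key

noncomputable def tt (a : ℕ) (n : ℕ) : ℂ := 1 + (a : ℂ) * (1 / ((n : ℂ) + 1))

lemma tt_eq (a n : ℕ) : tt a n = ((n + 1 + a : ℕ) : ℂ) / ((n + 1 : ℕ) : ℂ) := by
  have : ((n : ℂ) + 1) ≠ 0 := by exact_mod_cast Nat.succ_ne_zero n
  unfold tt
  push_cast
  field_simp

lemma tt_ne (a n : ℕ) : tt a n ≠ 0 := by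
  rw [tt_eq]
  refine div_ne_zero ?_ ?_ <;> (rw [Nat.cast_ne_zero]; omega)

lemma tt_sub (a n : ℕ) : tt a n - 1 = (a : ℂ) * (1 / ((n : ℂ) + 1)) := by
  unfold tt; ring

lemma tt_inj (a b n : ℕ) (h : a ≠ b) : tt a n ≠ tt b n := by
  have h1 : ((n : ℂ) + 1) ≠ 0 := by exact_mod_cast Nat.succ_ne_zero n
  intro e
  unfold tt at e
  have := mul_right_cancel₀ (one_div_ne_zero h1) (add_left_cancel e)
  exact h (by exact_mod_cast this)

lemma tt_tendsto (a : ℕ) : Filter.Tendsto (tt a) Filter.atTop (nhds 1) := by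
  have := ((tendsto_one_div_add_atTop_nhds_zero_nat (𝕜 := ℂ)).const_mul (a : ℂ)).const_add 1
  rw [mul_zero, add_zero] at this
  exact this

noncomputable def path (a b : ℕ) (n : ℕ) :
    ℙ ℂ (Fin 2 → ℂ) × ℙ ℂ (Fin 2 → ℂ) × ℙ ℂ (Fin 2 → ℂ) :=
  (pt (tt a n) 1 (Or.inl (tt_ne a n)), pt (tt b n) 1 (Or.inl (tt_ne b n)),
    pt (tt b n) (tt a n) (Or.inl (tt_ne b n)))

lemma path_mem (a b n : ℕ) (ha : a ≠ 0) (hb : b ≠ 0) (hab : a ≠ b) : path a b n ∈ Fset := by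
  have h0 : tt 0 n = 1 := by simp [tt]
  refine ⟨tt a n, 1, tt b n, 1, tt b n, tt a n, tt_ne _ _, tt_ne _ _, tt_ne _ _, one_ne_zero,
    one_ne_zero, tt_ne _ _, ?_, ?_, tt_inj _ _ _ hab.symm, by ring, rfl⟩
  · rw [← h0]; exact tt_inj _ _ _ ha
  · rw [← h0]; exact tt_inj _ _ _ hb

lemma path_tendsto (a b : ℕ) : Filter.Tendsto (path a b) Filter.atTop
    (nhds (pt 1 1 (Or.inl one_ne_zero), pt 1 1 (Or.inl one_ne_zero),
      pt 1 1 (Or.inl one_ne_zero))) := by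
  refine Filter.Tendsto.prodMk_nhds ?_ (Filter.Tendsto.prodMk_nhds ?_ ?_)
  · exact pt_tendsto _ (fun _ => 1) _ (tt_tendsto a) tendsto_const_nhds
  · exact pt_tendsto _ (fun _ => 1) _ (tt_tendsto b) tendsto_const_nhds
  · exact pt_tendsto _ _ _ (tt_tendsto b) (tt_tendsto a)

lemma path_phi (a b n : ℕ) (ha : a ≠ 0) : gP (phiFun (path a b n)).2.2 =
    ‖a * tt b n‖ ^ 2 / (‖a * tt b n‖ ^ 2 + ‖b * tt a n‖ ^ 2) := by
  have h1 : ((n : ℂ) + 1) ≠ 0 := by exact_mod_cast Nat.succ_ne_zero n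
  obtain ⟨m1, hm1, e1, f1⟩ := rep_pt (tt a n) 1 (Or.inl (tt_ne a n))
  obtain ⟨m2, hm2, e2, f2⟩ := rep_pt (tt b n) 1 (Or.inl (tt_ne b n))
  obtain ⟨m3, hm3, e3, f3⟩ := rep_pt (tt b n) (tt a n) (Or.inl (tt_ne b n))
  rw [← gP_pt' (m1 * m2 * m3 * (1 / ((n : ℂ) + 1))) _ _
    (mul_ne_zero (mul_ne_zero (mul_ne_zero hm1 hm2) hm3) (one_div_ne_zero h1))
    (mul_ne_zero (Nat.cast_ne_zero.2 ha) (tt_ne b n))]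
  simp only [phiFun, path, e1, f1, e2, f2, e3, f3]
  congr 2
  · linear_combination (m1 * m2 * m3 * tt b n) * tt_sub a n
  · linear_combination (m1 * m2 * m3 * tt a n) * tt_sub b n

lemma path_lim (a b : ℕ) (ha : a ≠ 0) :
    Filter.Tendsto (fun n => gP (phiFun (path a b n)).2.2) Filter.atTop
      (nhds ((a : ℝ) ^ 2 / ((a : ℝ) ^ 2 + (b : ℝ) ^ 2))) := by
  simp only [path_phi a b _ ha]
  have A : Filter.Tendsto (fun n => ‖a * tt b n‖ ^ 2) Filter.atTop (nhds ((a : ℝ) ^ 2)) := by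
    simpa using (((tt_tendsto b).const_mul (a : ℂ)).norm.pow 2)
  have B : Filter.Tendsto (fun n => ‖b * tt a n‖ ^ 2) Filter.atTop (nhds ((b : ℝ) ^ 2)) := by
    simpa using (((tt_tendsto a).const_mul (b : ℂ)).norm.pow 2)
  refine A.div (A.add B) ?_
  have : (0 : ℝ) < a := by exact_mod_cast Nat.pos_of_ne_zero ha
  positivity

/-- The point `p = ((1:1), (1:1), (1:1))` lies in the closure of the space of parameters `F` of
the main stratum of `G_{5,2}`, yet the transition map `φ = f₁₂,₁₃` has no limit at `p` along
`F`: it cannot be continuously extended to this point.  (This is the reason the universal space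
of parameters of `G_{5,2}` is obtained by blowing up this point.) -/
theorem transition_has_no_limit_at_center :
    (pt 1 1 (Or.inl one_ne_zero), pt 1 1 (Or.inl one_ne_zero), pt 1 1 (Or.inl one_ne_zero)) ∈
      closure Fset ∧
    ¬ ∃ q : ℙ ℂ (Fin 2 → ℂ) × ℙ ℂ (Fin 2 → ℂ) × ℙ ℂ (Fin 2 → ℂ),
      Filter.Tendsto phiFun
        (nhdsWithin
          (pt 1 1 (Or.inl one_ne_zero), pt 1 1 (Or.inl one_ne_zero),
            pt 1 1 (Or.inl one_ne_zero)) Fset)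
        (nhds q) := by
  refine ⟨mem_closure_of_tendsto (path_tendsto 1 2) (Filter.Eventually.of_forall fun n =>
    path_mem 1 2 n (by norm_num) (by norm_num) (by norm_num)), ?_⟩
  rintro ⟨q, hq⟩
  have key : ∀ a b : ℕ, a ≠ 0 → b ≠ 0 → a ≠ b →
      gP q.2.2 = (a : ℝ) ^ 2 / ((a : ℝ) ^ 2 + (b : ℝ) ^ 2) := by
    intro a b ha hb hab
    have h1 := hq.comp (tendsto_nhdsWithin_iff.2 ⟨path_tendsto a b,
      Filter.Eventually.of_forall fun n => path_mem a b n ha hb hab⟩)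
    have hc : Continuous (fun p : ℙ ℂ (Fin 2 → ℂ) × ℙ ℂ (Fin 2 → ℂ) × ℙ ℂ (Fin 2 → ℂ) =>
      gP p.2.2) := gP_cont.comp (continuous_snd.comp continuous_snd)
    exact tendsto_nhds_unique ((hc.tendsto q).comp h1) (path_lim a b ha)
  have h12 := key 1 2 (by norm_num) (by norm_num) (by norm_num)
  have h21 := key 2 1 (by norm_num) (by norm_num) (by norm_num)
  rw [h12] at h21
  norm_num at h21
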